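/- Suppose c ≥ 0, the exact moment problem is feasible with optimal value p*, and for each d ∈ ℕ we are given continuous functions g_i^{(d)} : [a,b] → ℝ^m, vectors h^{(d)} ∈ ℝ^n, and numbers e_d ≥ 0 with e_d → 0, such that sup_{t ∈ [a,b]} |g^{(d)}_{i,j}(t) − g_{i,j}(t)| ≤ e_d for all i, j and |h^{(d)}_i − h_i| ≤ c·e_d for all i. Define p̃_d := inf { ‖μ‖_TV : μ ∈ M([a,b]; ℝ^m), |⟨g_i^{(d)}, μ⟩ − h^{(d)}_i| ≤ e_d·(c + ‖μ‖_TV) for all i = 1,…,n }. Then p̃_d ≤ p* for every d, and p̃_d → p* as d → ∞. -/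

import Mathlib

open MeasureTheory

attribute [local instance] MeasureTheory.Measure.Subtype.measureSpace

/-- Integral of a function against a finite signed measure, via Jordan decomposition. -/
noncomputable def sigInt {X : Type*} [MeasurableSpace X] (f : X → ℝ) (μ : SignedMeasure X) : ℝ :=
  (∫ t, f t ∂μ.toJordanDecomposition.posPart) - ∫ t, f t ∂μ.toJordanDecomposition.negPart

/-- Total variation norm of an m-vector of finite signed measures. -/
noncomputable def tvn {X : Type*} [MeasurableSpace X] {m : ℕ} (μ : Fin m → SignedMeasure X) : ℝ :=
  ∑ j, ((μ j).totalVariation Set.univ).toReal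

/-- The duality bracket ⟨g_i, μ⟩ = Σ_j ∫ g_{i,j} dμ_j. -/
noncomputable def bra {X : Type*} [MeasurableSpace X] {m : ℕ}
    (g : Fin m → X → ℝ) (μ : Fin m → SignedMeasure X) : ℝ :=
  ∑ j, sigInt (g j) (μ j)

open Filter


open MeasureTheory in
/-- integrability against every finite measure -/
def FInt {X : Type*} [MeasurableSpace X] (f : X → ℝ) : Prop :=
  ∀ (ν : Measure X) [IsFiniteMeasure ν], Integrable f ν

section helpers
variable {X : Type*} [MeasurableSpace X]

lemma sigInt_eq {f : X → ℝ} (hf : FInt f) (s : SignedMeasure X) (p q : Measure X)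
    [IsFiniteMeasure p] [IsFiniteMeasure q] (hs : s = p.toSignedMeasure - q.toSignedMeasure) :
    sigInt f s = ∫ t, f t ∂p - ∫ t, f t ∂q := by
  have h1 := s.toSignedMeasure_toJordanDecomposition
  rw [JordanDecomposition.toSignedMeasure] at h1
  have h2 : s.toJordanDecomposition.posPart + q = p + s.toJordanDecomposition.negPart := by
    rw [← Measure.toSignedMeasure_eq_toSignedMeasure_iff, Measure.toSignedMeasure_add,
      Measure.toSignedMeasure_add, ← sub_eq_sub_iff_add_eq_add, h1, hs]
  have h3 : ∫ t, f t ∂(s.toJordanDecomposition.posPart + q)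
      = ∫ t, f t ∂(p + s.toJordanDecomposition.negPart) := by rw [h2]
  rw [integral_add_measure (hf _) (hf _), integral_add_measure (hf _) (hf _)] at h3
  unfold sigInt
  linarith

lemma sigInt_add {f : X → ℝ} (hf : FInt f) (s t : SignedMeasure X) :
    sigInt f (s + t) = sigInt f s + sigInt f t := by
  have h1 := s.toSignedMeasure_toJordanDecomposition
  have h2 := t.toSignedMeasure_toJordanDecomposition
  rw [JordanDecomposition.toSignedMeasure] at h1 h2
  rw [sigInt_eq hf (s + t) (s.toJordanDecomposition.posPart + t.toJordanDecomposition.posPart)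
    (s.toJordanDecomposition.negPart + t.toJordanDecomposition.negPart),
    integral_add_measure (hf _) (hf _), integral_add_measure (hf _) (hf _)]
  · unfold sigInt; ring
  · rw [Measure.toSignedMeasure_add, Measure.toSignedMeasure_add, add_sub_add_comm, h1, h2]

lemma sigInt_smul (f : X → ℝ) (r : ℝ) (s : SignedMeasure X) :
    sigInt f (r • s) = r * sigInt f s := by
  unfold sigInt
  rw [SignedMeasure.toJordanDecomposition_smul_real]
  rcases le_or_gt 0 r with hr | hr
  · rw [JordanDecomposition.real_smul_posPart_nonneg _ _ hr,
      JordanDecomposition.real_smul_negPart_nonneg _ _ hr, integral_smul_nnreal_measure,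
      integral_smul_nnreal_measure, NNReal.smul_def, NNReal.smul_def, Real.coe_toNNReal _ hr,
      smul_eq_mul, smul_eq_mul]
    ring
  · rw [JordanDecomposition.real_smul_posPart_neg _ _ hr,
      JordanDecomposition.real_smul_negPart_neg _ _ hr, integral_smul_nnreal_measure,
      integral_smul_nnreal_measure, NNReal.smul_def, NNReal.smul_def,
      Real.coe_toNNReal _ (by linarith), smul_eq_mul, smul_eq_mul]
    ring

lemma sigInt_diff_le {f f' : X → ℝ} (hf : FInt f) (hf' : FInt f') {e : ℝ}
    (he : ∀ t, |f' t - f t| ≤ e) (s : SignedMeasure X) :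
    |sigInt f' s - sigInt f s| ≤ e * (s.totalVariation Set.univ).toReal := by
  have key : ∀ (p : Measure X) [IsFiniteMeasure p],
      |∫ t, f' t ∂p - ∫ t, f t ∂p| ≤ e * (p Set.univ).toReal := by
    intro p _
    rw [← integral_sub (hf' p) (hf p)]
    exact norm_integral_le_of_norm_le_const (μ := p) (f := fun t => f' t - f t)
      (Filter.Eventually.of_forall he)
  have h1 := key s.toJordanDecomposition.posPart
  have h2 := key s.toJordanDecomposition.negPart
  unfold sigInt SignedMeasure.totalVariation
  rw [Measure.add_apply, ENNReal.toReal_add (measure_ne_top _ _) (measure_ne_top _ _)]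
  rw [abs_le] at *
  constructor <;> linarith [h1.1, h1.2, h2.1, h2.2]

lemma tvn_nonneg {m : ℕ} (μ : Fin m → SignedMeasure X) : 0 ≤ tvn μ :=
  Finset.sum_nonneg fun _ _ => ENNReal.toReal_nonneg

lemma tvn_add_le {m : ℕ} (μ ν : Fin m → SignedMeasure X) : tvn (μ + ν) ≤ tvn μ + tvn ν := by
  unfold tvn
  rw [← Finset.sum_add_distrib]
  refine Finset.sum_le_sum fun j _ => ?_
  rw [← ENNReal.toReal_add (measure_ne_top _ _) (measure_ne_top _ _)]
  refine ENNReal.toReal_mono (by finiteness) ?_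
  simp only [SignedMeasure.totalVariation_eq_variation, Pi.add_apply]
  exact VectorMeasure.variation_add_le Set.univ

lemma tvn_smul {m : ℕ} (r : ℝ) (μ : Fin m → SignedMeasure X) : tvn (r • μ) = |r| * tvn μ := by
  unfold tvn
  rw [Finset.mul_sum]
  refine Finset.sum_congr rfl fun j _ => ?_
  simp [SignedMeasure.totalVariation_eq_variation, VectorMeasure.variation_smul]

lemma tvn_zero {m : ℕ} : tvn (0 : Fin m → SignedMeasure X) = 0 := by
  simpa using tvn_smul (0 : ℝ) (0 : Fin m → SignedMeasure X)

lemma tvn_sum_le {m : ℕ} {ι : Type*} (s : Finset ι) (μ : ι → Fin m → SignedMeasure X) :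
    tvn (∑ i ∈ s, μ i) ≤ ∑ i ∈ s, tvn (μ i) := by
  classical
  induction s using Finset.induction_on with
  | empty => simp [tvn_zero]
  | insert a s ha ih =>
    rw [Finset.sum_insert ha, Finset.sum_insert ha]
    exact (tvn_add_le _ _).trans (by linarith)

lemma bra_diff_le {m : ℕ} {g g' : Fin m → X → ℝ} (hg : ∀ j, FInt (g j)) (hg' : ∀ j, FInt (g' j))
    {e : ℝ} (he : ∀ j t, |g' j t - g j t| ≤ e) (μ : Fin m → SignedMeasure X) :
    |bra g' μ - bra g μ| ≤ e * tvn μ := by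
  unfold bra tvn
  rw [← Finset.sum_sub_distrib, Finset.mul_sum]
  exact (Finset.abs_sum_le_sum_abs _ _).trans
    (Finset.sum_le_sum fun j _ => sigInt_diff_le (hg j) (hg' j) (he j) (μ j))

/-- the moment map -/
noncomputable def momMap {m n : ℕ} (g : Fin n → Fin m → X → ℝ) (hg : ∀ i j, FInt (g i j)) :
    (Fin m → SignedMeasure X) →ₗ[ℝ] (Fin n → ℝ) where
  toFun μ i := bra (g i) μ
  map_add' μ ν := by
    ext i
    simp [bra, sigInt_add (hg i _), Finset.sum_add_distrib]
  map_smul' r μ := by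
    ext i
    simp [bra, sigInt_smul, Finset.mul_sum]

lemma exists_corr {m n : ℕ} (g : Fin n → Fin m → X → ℝ) (hg : ∀ i j, FInt (g i j)) :
    ∃ C : ℝ, 0 ≤ C ∧ ∀ (μ : Fin m → SignedMeasure X) (δ : ℝ), (∀ i, |bra (g i) μ| ≤ δ) →
      ∃ ν : Fin m → SignedMeasure X, (∀ i, bra (g i) ν = bra (g i) μ) ∧ tvn ν ≤ C * δ := by
  set T := momMap g hg with hT
  obtain ⟨S, hS⟩ := T.rangeRestrict.exists_rightInverse_of_surjective T.range_rangeRestrict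
  obtain ⟨S', hS'⟩ := S.exists_extend
  refine ⟨∑ i, tvn (S' (Pi.single i 1)), Finset.sum_nonneg fun _ _ => tvn_nonneg _, ?_⟩
  intro μ δ hδ
  refine ⟨S' (T μ), ?_, ?_⟩
  · have h1 : S' (T μ) = S (T.rangeRestrict μ) := by
      rw [← hS']; rfl
    have h2 : T (S (T.rangeRestrict μ)) = T μ :=
      congrArg Subtype.val (LinearMap.congr_fun hS (T.rangeRestrict μ))
    intro i
    have := congrFun h2 i
    rw [← h1] at this
    exact this
  · have h1 : S' (T μ) = ∑ i, (T μ i) • S' (Pi.single i 1) := by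
      conv_lhs => rw [pi_eq_sum_univ' (T μ)]
      simp [map_sum]
    rw [h1, Finset.sum_mul]
    refine (tvn_sum_le _ _).trans (Finset.sum_le_sum fun i _ => ?_)
    rw [tvn_smul, mul_comm]
    exact mul_le_mul_of_nonneg_left (hδ i) (tvn_nonneg _)

theorem core {m n : ℕ}
    (g : Fin n → Fin m → X → ℝ) (hg : ∀ i j, FInt (g i j))
    (h : Fin n → ℝ) (c : ℝ) (hc : 0 ≤ c)
    (hfeas : ∃ μ : Fin m → SignedMeasure X, ∀ i, bra (g i) μ = h i)
    (gd : ℕ → Fin n → Fin m → X → ℝ)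
    (hgd : ∀ d i j, FInt (gd d i j))
    (hd : ℕ → Fin n → ℝ)
    (ed : ℕ → ℝ) (hed : ∀ d, 0 ≤ ed d)
    (hed0 : Tendsto ed atTop (nhds 0))
    (hgerr : ∀ d i j, ∀ t : X, |gd d i j t - g i j t| ≤ ed d)
    (hherr : ∀ d i, |hd d i - h i| ≤ c * ed d) :
    (∀ d : ℕ,
      sInf {r : ℝ | ∃ μ : Fin m → SignedMeasure X,
          (∀ i, |bra (gd d i) μ - hd d i| ≤ ed d * (c + tvn μ)) ∧ r = tvn μ} ≤
      sInf {r : ℝ | ∃ μ : Fin m → SignedMeasure X,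
          (∀ i, bra (g i) μ = h i) ∧ r = tvn μ}) ∧
    Tendsto (fun d : ℕ =>
        sInf {r : ℝ | ∃ μ : Fin m → SignedMeasure X,
          (∀ i, |bra (gd d i) μ - hd d i| ≤ ed d * (c + tvn μ)) ∧ r = tvn μ})
      atTop
      (nhds (sInf {r : ℝ | ∃ μ : Fin m → SignedMeasure X,
          (∀ i, bra (g i) μ = h i) ∧ r = tvn μ})) := by
  set P : Set ℝ := {r : ℝ | ∃ μ : Fin m → SignedMeasure X,
          (∀ i, bra (g i) μ = h i) ∧ r = tvn μ} with hP
  set Q : ℕ → Set ℝ := fun d => {r : ℝ | ∃ μ : Fin m → SignedMeasure X,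
          (∀ i, |bra (gd d i) μ - hd d i| ≤ ed d * (c + tvn μ)) ∧ r = tvn μ} with hQ
  have hPQ : ∀ d, P ⊆ Q d := by
    rintro d r ⟨μ, h1, rfl⟩
    refine ⟨μ, fun i => ?_, rfl⟩
    have h2 := bra_diff_le (hg i) (hgd d i) (hgerr d i) μ
    have h3 := hherr d i
    rw [h1 i] at h2
    rw [abs_le] at *
    constructor <;> linarith [h2.1, h2.2, h3.1, h3.2]
  have hPne : P.Nonempty := by
    obtain ⟨μ, hμ⟩ := hfeas
    exact ⟨_, μ, hμ, rfl⟩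
  have hPb : BddBelow P := ⟨0, by rintro r ⟨μ, -, rfl⟩; exact tvn_nonneg μ⟩
  have hQb : ∀ d, BddBelow (Q d) := fun d => ⟨0, by rintro r ⟨μ, -, rfl⟩; exact tvn_nonneg μ⟩
  have hle : ∀ d, sInf (Q d) ≤ sInf P := fun d => csInf_le_csInf (hQb d) hPne (hPQ d)
  refine ⟨hle, ?_⟩
  obtain ⟨C, hC, hcorr⟩ := exists_corr g hg
  obtain ⟨μ0, hμ0⟩ := hfeas
  have hlow : ∀ d, sInf P - C * (ed d * (2 * c + 2 * (sInf P + 1))) ≤ sInf (Q d) := by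
    intro d
    refine le_of_forall_pos_lt_add fun ε hε => ?_
    obtain ⟨r, ⟨μ, hμ, rfl⟩, hr⟩ := exists_lt_of_csInf_lt (hPne.mono (hPQ d))
      (show sInf (Q d) < sInf (Q d) + min ε 1 by linarith [lt_min hε one_pos])
    have hμ1 : tvn μ ≤ sInf P + 1 := by linarith [hle d, min_le_right ε 1]
    have hμε : tvn μ < sInf (Q d) + ε := by linarith [min_le_left ε 1]
    have hsub : ∀ i, bra (g i) (μ0 - μ) = h i - bra (g i) μ := by
      intro i
      have := congrFun ((momMap g hg).map_sub μ0 μ) i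
      rw [← hμ0 i]
      exact this
    obtain ⟨ν, hν1, hν2⟩ := hcorr (μ0 - μ) (ed d * (2 * c + 2 * (sInf P + 1))) (by
      intro i
      rw [hsub i]
      have h2 := bra_diff_le (hg i) (hgd d i) (hgerr d i) μ
      have h3 := hherr d i
      have h4 := hμ i
      have h5 : ed d * tvn μ ≤ ed d * (sInf P + 1) := mul_le_mul_of_nonneg_left hμ1 (hed d)
      rw [abs_le] at *
      constructor <;> linarith [h2.1, h2.2, h3.1, h3.2, h4.1, h4.2])
    have hmem : tvn (μ + ν) ∈ P := by
      refine ⟨μ + ν, fun i => ?_, rfl⟩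
      have := congrFun ((momMap g hg).map_add μ ν) i
      have h6 : bra (g i) (μ + ν) = bra (g i) μ + bra (g i) ν := this
      rw [h6, hν1 i, hsub i]
      ring
    have := csInf_le hPb hmem
    linarith [tvn_add_le μ ν]
  refine tendsto_of_tendsto_of_tendsto_of_le_of_le ?_ tendsto_const_nhds hlow hle
  have := (tendsto_const_nhds (x := sInf P)).sub
    ((hed0.mul_const (2 * c + 2 * (sInf P + 1))).const_mul C)
  simpa using this

end helpers

lemma fint_of_continuous {a b : ℝ} {f : Set.Icc a b → ℝ} (hf : Continuous f) : FInt f := by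
  intro ν _
  exact (BoundedContinuousFunction.mkOfCompact ⟨f, hf⟩).integrable ν

/-- For a sequence of approximate data `(g^{(d)}, h^{(d)})` with errors
`e_d → 0`, the approximate relaxed values `p̃_d` satisfy `p̃_d ≤ p*` for every `d` and
`p̃_d → p*` as `d → ∞`. -/
theorem stmt12 {m n : ℕ} {a b : ℝ} (hab : a < b)
    (g : Fin n → Fin m → Set.Icc a b → ℝ) (hg : ∀ i j, Continuous (g i j))
    (h : Fin n → ℝ) (c : ℝ) (hc : 0 ≤ c)
    (hfeas : ∃ μ : Fin m → SignedMeasure (Set.Icc a b), ∀ i, bra (g i) μ = h i)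
    (gd : ℕ → Fin n → Fin m → Set.Icc a b → ℝ)
    (hgd : ∀ d i j, Continuous (gd d i j))
    (hd : ℕ → Fin n → ℝ)
    (ed : ℕ → ℝ) (hed : ∀ d, 0 ≤ ed d)
    (hed0 : Tendsto ed atTop (nhds 0))
    (hgerr : ∀ d i j, ∀ t : Set.Icc a b, |gd d i j t - g i j t| ≤ ed d)
    (hherr : ∀ d i, |hd d i - h i| ≤ c * ed d) :
    (∀ d : ℕ,
      sInf {r : ℝ | ∃ μ : Fin m → SignedMeasure (Set.Icc a b),
          (∀ i, |bra (gd d i) μ - hd d i| ≤ ed d * (c + tvn μ)) ∧ r = tvn μ} ≤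
      sInf {r : ℝ | ∃ μ : Fin m → SignedMeasure (Set.Icc a b),
          (∀ i, bra (g i) μ = h i) ∧ r = tvn μ}) ∧
    Tendsto (fun d : ℕ =>
        sInf {r : ℝ | ∃ μ : Fin m → SignedMeasure (Set.Icc a b),
          (∀ i, |bra (gd d i) μ - hd d i| ≤ ed d * (c + tvn μ)) ∧ r = tvn μ})
      atTop
      (nhds (sInf {r : ℝ | ∃ μ : Fin m → SignedMeasure (Set.Icc a b),
          (∀ i, bra (g i) μ = h i) ∧ r = tvn μ})) := by
  exact core g (fun i j => fint_of_continuous (hg i j)) h c hc hfeas gd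
    (fun d i j => fint_of_continuous (hgd d i j)) hd ed hed hed0 hgerr hherr
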